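/- There exists a universal constant c > 0 with the following property. Let p ≥ 1 and let K ⊂ ℝⁿ be a centrally symmetric convex body of volume 1 which is p-convex with constant α > 0, with Euclidean diameter d_K. Let f : ℝⁿ → ℝ be 1-Lipschitz with respect to the Euclidean metric, and let E(f) = ∫_K f(x) dx. Then for every t > 0, the Lebesgue measure of {x ∈ K : |f(x) − E(f)| ≥ t} is at most 4·exp(−2·c^p·αn(t/d_K)^p). -/

import Mathlib

open MeasureTheory
open scoped RealInnerProductSpace

noncomputable section

/-- A centrally symmetric convex body: compact, convex, with nonempty interior,
and symmetric about the origin. -/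
def IsSymmConvexBody {E : Type*} [NormedAddCommGroup E] [NormedSpace ℝ E]
    (K : Set E) : Prop :=
  IsCompact K ∧ Convex ℝ K ∧ (interior K).Nonempty ∧ K = -K

/-- The modulus of convexity of `K`, defined via the gauge (Minkowski functional) of `K`. -/
def modulusOfConvexity {E : Type*} [AddCommGroup E] [Module ℝ E]
    (K : Set E) (ε : ℝ) : ℝ :=
  sInf { d | ∃ x y : E, gauge K x ≤ 1 ∧ gauge K y ≤ 1 ∧ ε ≤ gauge K (x - y) ∧
    d = 1 - gauge K ((2:ℝ)⁻¹ • (x + y)) }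

/-- `K` is 2-convex with constant `α`: `δ_K(ε) ≥ α ε²` for all `0 < ε ≤ 2`. -/
def IsTwoConvex {E : Type*} [AddCommGroup E] [Module ℝ E]
    (K : Set E) (α : ℝ) : Prop :=
  ∀ ε : ℝ, 0 < ε → ε ≤ 2 → α * ε ^ 2 ≤ modulusOfConvexity K ε

/-- `K` is `p`-convex with constant `α`: `δ_K(ε) ≥ α ε^p` for all `0 < ε ≤ 2`. -/
def IsPConvex {E : Type*} [AddCommGroup E] [Module ℝ E]
    (K : Set E) (p α : ℝ) : Prop :=
  ∀ ε : ℝ, 0 < ε → ε ≤ 2 → α * ε ^ p ≤ modulusOfConvexity K ε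

section PrekopaLeindler

open Set ENNReal
open scoped Pointwise

/-- The one-dimensional Brunn–Minkowski inequality for midpoints. -/
theorem Real.volume_add_volume_le_of_midpoint_mem {A B C : Set ℝ} (hA : MeasurableSet A)
    (hB : MeasurableSet B) (hA' : A.Nonempty) (hB' : B.Nonempty)
    (hC : ∀ x ∈ A, ∀ y ∈ B, (2 : ℝ)⁻¹ * (x + y) ∈ C) :
    volume A + volume B ≤ 2 * volume C := by
  have key : ∀ S T : Set ℝ, S ⊆ A → T ⊆ B → IsCompact S → IsCompact T → S.Nonempty →
      T.Nonempty → volume S + volume T ≤ 2 * volume C := by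
    intro S T hSA hTB hS hT hSn hTn
    obtain ⟨a, ha, hamax⟩ := hS.exists_isGreatest hSn
    obtain ⟨b, hb, hbmin⟩ := hT.exists_isLeast hTn
    have hsub : (fun x : ℝ ↦ x + b) '' S ∪ (fun y : ℝ ↦ y + a) '' T ⊆ (2 : ℝ) • C := by
      rintro z (⟨x, hx, rfl⟩ | ⟨y, hy, rfl⟩)
      · exact ⟨_, hC x (hSA hx) b (hTB hb), by simp⟩
      · exact ⟨_, hC a (hSA ha) y (hTB hy), by simp [add_comm]⟩
    have hinter : volume (((fun x : ℝ ↦ x + b) '' S) ∩ ((fun y : ℝ ↦ y + a) '' T)) = 0 := by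
      refine measure_mono_null (t := {a + b}) ?_ Real.volume_singleton
      rintro z ⟨⟨x, hx, rfl⟩, ⟨y, hy, h⟩⟩
      have h1 := hamax hx
      have h2 := hbmin hy
      simp only [mem_singleton_iff] at *
      linarith
    have hm : MeasurableSet ((fun y : ℝ ↦ y + a) '' T) :=
      (hT.image (by fun_prop)).measurableSet
    have h1 := measure_union_add_inter (μ := volume) ((fun x : ℝ ↦ x + b) '' S) hm
    rw [hinter, add_zero, image_add_right, image_add_right, measure_preimage_add_right,
      measure_preimage_add_right, ← image_add_right, ← image_add_right] at h1
    rw [← h1]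
    simpa using (measure_mono hsub).trans_eq (Measure.addHaar_smul volume (2 : ℝ) C)
  obtain ⟨a, ha⟩ := hA'
  obtain ⟨b, hb⟩ := hB'
  rw [hA.measure_eq_iSup_isCompact, hB.measure_eq_iSup_isCompact]
  simp only [iSup_and']
  refine ENNReal.biSup_add_biSup_le' ⟨∅, empty_subset _, isCompact_empty⟩
    ⟨∅, empty_subset _, isCompact_empty⟩ ?_
  rintro S ⟨hS, hSc⟩ T ⟨hT, hTc⟩
  refine le_trans (add_le_add (measure_mono (subset_insert a S)) (measure_mono (subset_insert b T)))
    (key _ _ (insert_subset ha hS) (insert_subset hb hT) (hSc.insert a) (hTc.insert b)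
      (insert_nonempty _ _) (insert_nonempty _ _))

theorem ENNReal.mul_le_sq_of_add_le_two_mul {a b c : ℝ≥0∞} (h : a + b ≤ 2 * c) :
    a * b ≤ c ^ 2 := by
  by_cases hc : c = ∞
  · simp [hc]
  have hab : a + b ≠ ∞ := (h.trans_lt (ENNReal.mul_lt_top (by simp) (Ne.lt_top hc))).ne
  obtain ⟨ha, hb⟩ := ENNReal.add_ne_top.1 hab
  lift a to NNReal using ha
  lift b to NNReal using hb
  lift c to NNReal using hc
  norm_cast at *
  rw [← NNReal.coe_le_coe] at *
  push_cast at *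
  nlinarith [sq_nonneg ((a : ℝ) - b), a.2, b.2, c.2]

/-- The Prékopa–Leindler inequality on the line (midpoint form) for bounded functions. -/
theorem Real.prekopaLeindler_of_bddAbove {f g h : ℝ → ℝ} (hf : Measurable f) (hg : Measurable g)
    (hh : Measurable h) (hf0 : 0 ≤ f) (hg0 : 0 ≤ g) (hh0 : 0 ≤ h)
    (hfb : BddAbove (range f)) (hgb : BddAbove (range g))
    (H : ∀ x y, f x * g y ≤ h ((2 : ℝ)⁻¹ * (x + y)) ^ 2) :
    (∫⁻ x, ENNReal.ofReal (f x)) * (∫⁻ x, ENNReal.ofReal (g x)) ≤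
      (∫⁻ x, ENNReal.ofReal (h x)) ^ 2 := by
  set F := ⨆ x, f x
  set G := ⨆ x, g x
  have hfF : ∀ x, f x ≤ F := le_ciSup hfb
  have hgG : ∀ x, g x ≤ G := le_ciSup hgb
  rcases ((hf0 0).trans (hfF 0)).eq_or_lt with hF0 | (hFpos : 0 < F)
  · have : ∀ x, f x = 0 := fun x ↦ le_antisymm ((hfF x).trans_eq hF0.symm) (hf0 x)
    simp [this]
  rcases ((hg0 0).trans (hgG 0)).eq_or_lt with hG0 | (hGpos : 0 < G)
  · have : ∀ x, g x = 0 := fun x ↦ le_antisymm ((hgG x).trans_eq hG0.symm) (hg0 x)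
    simp [this]
  have hFG : 0 < √(F * G) := by positivity
  have level : ∀ s ∈ Ioi (0 : ℝ), volume {x | s < f x / F} + volume {x | s < g x / G} ≤
      2 * volume {x | s < h x / √(F * G)} := by
    intro s hs
    rw [mem_Ioi] at hs
    rcases lt_or_ge s 1 with hs1 | hs1
    · refine Real.volume_add_volume_le_of_midpoint_mem
        (measurableSet_lt measurable_const (hf.div_const _))
        (measurableSet_lt measurable_const (hg.div_const _)) ?_ ?_ ?_
      · obtain ⟨x, hx⟩ := exists_lt_of_lt_ciSup (show s * F < ⨆ x, f x by nlinarith)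
        exact ⟨x, (lt_div_iff₀ hFpos).2 hx⟩
      · obtain ⟨x, hx⟩ := exists_lt_of_lt_ciSup (show s * G < ⨆ x, g x by nlinarith)
        exact ⟨x, (lt_div_iff₀ hGpos).2 hx⟩
      · intro x hx y hy
        have hx' : s * F < f x := (lt_div_iff₀ hFpos).1 hx
        have hy' : s * G < g y := (lt_div_iff₀ hGpos).1 hy
        refine (lt_div_iff₀ hFG).2 (lt_of_pow_lt_pow_left₀ 2 (hh0 _) ?_)
        rw [mul_pow, Real.sq_sqrt (by positivity)]
        calc s ^ 2 * (F * G) = (s * F) * (s * G) := by ring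
          _ < f x * g y := mul_lt_mul'' hx' hy' (by positivity) (by positivity)
          _ ≤ _ := H x y
    · have h1 : {x | s < f x / F} = ∅ := eq_empty_of_forall_notMem fun x (hx : s < f x / F) ↦ by
        have := (lt_div_iff₀ hFpos).1 hx
        nlinarith [hfF x]
      have h2 : {x | s < g x / G} = ∅ := eq_empty_of_forall_notMem fun x (hx : s < g x / G) ↦ by
        have := (lt_div_iff₀ hGpos).1 hx
        nlinarith [hgG x]
      simp [h1, h2]
  have layer : ∀ u : ℝ → ℝ, ∀ U : ℝ, Measurable u → 0 ≤ u → 0 < U →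
      ∫⁻ x, ENNReal.ofReal (u x) =
        ENNReal.ofReal U * ∫⁻ s in Ioi 0, volume {x | s < u x / U} := by
    intro u U hu hu0 hU
    rw [← lintegral_eq_lintegral_meas_lt volume
      (Filter.Eventually.of_forall fun x ↦ div_nonneg (hu0 x) hU.le) (by fun_prop),
      ← lintegral_const_mul _ (by fun_prop)]
    congr 1 with x
    rw [← ENNReal.ofReal_mul hU.le, mul_div_cancel₀ _ hU.ne']
  have hmeas : ∀ (u : ℝ → ℝ), Measurable fun s : ℝ ↦ volume {x | s < u x} := fun u ↦
    Antitone.measurable fun s t hst ↦ measure_mono fun x (hx : t < u x) ↦ hst.trans_lt hx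
  have h_int : (∫⁻ s in Ioi 0, volume {x | s < f x / F}) +
      (∫⁻ s in Ioi 0, volume {x | s < g x / G}) ≤
      2 * ∫⁻ s in Ioi 0, volume {x | s < h x / √(F * G)} := by
    rw [← lintegral_add_left (hmeas _), ← lintegral_const_mul _ (hmeas _)]
    exact setLIntegral_mono' measurableSet_Ioi level
  rw [layer f F hf hf0 hFpos, layer g G hg hg0 hGpos, layer h _ hh hh0 hFG]
  calc _ = (ENNReal.ofReal F * ENNReal.ofReal G) * ((∫⁻ s in Ioi 0, volume {x | s < f x / F}) *
        (∫⁻ s in Ioi 0, volume {x | s < g x / G})) := by ring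
    _ ≤ (ENNReal.ofReal F * ENNReal.ofReal G) *
        (∫⁻ s in Ioi 0, volume {x | s < h x / √(F * G)}) ^ 2 := by
      gcongr
      exact ENNReal.mul_le_sq_of_add_le_two_mul h_int
    _ = _ := by
      rw [mul_pow, ← ENNReal.ofReal_pow hFG.le, Real.sq_sqrt (by positivity),
        ENNReal.ofReal_mul hFpos.le]

/-- A measure satisfies the midpoint Prékopa–Leindler inequality. -/
def PrekopaLeindler {E : Type*} [AddCommGroup E] [Module ℝ E] [MeasurableSpace E]
    (μ : Measure E) : Prop :=
  ∀ f g h : E → ℝ≥0∞, Measurable f → Measurable g → Measurable h →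
    (∀ x y, f x * g y ≤ h ((2 : ℝ)⁻¹ • (x + y)) ^ 2) →
    (∫⁻ x, f x ∂μ) * (∫⁻ x, g x ∂μ) ≤ (∫⁻ x, h x ∂μ) ^ 2

theorem prekopaLeindler_real : PrekopaLeindler (volume : Measure ℝ) := by
  intro f g h hf hg hh H
  have trunc : ∀ N : ℕ, (∫⁻ x, min (f x) N) * (∫⁻ x, min (g x) N) ≤ (∫⁻ x, h x) ^ 2 := by
    intro N
    have hfin : ∀ (u : ℝ → ℝ≥0∞) x, min (u x) N ≠ ∞ := fun u x ↦
      ((min_le_right _ _).trans_lt (ENNReal.natCast_lt_top N)).ne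
    have hbdd : ∀ u : ℝ → ℝ≥0∞, BddAbove (range fun x ↦ (min (u x) N).toReal) := by
      rintro u
      refine ⟨N, ?_⟩
      rintro _ ⟨x, rfl⟩
      simpa using ENNReal.toReal_mono (ENNReal.natCast_ne_top N) (min_le_right (u x) (N : ℝ≥0∞))
    have := Real.prekopaLeindler_of_bddAbove (f := fun x ↦ (min (f x) N).toReal)
      (g := fun x ↦ (min (g x) N).toReal) (h := fun x ↦ (min (h x) N).toReal)
      (by fun_prop) (by fun_prop) (by fun_prop) (fun _ ↦ toReal_nonneg) (fun _ ↦ toReal_nonneg)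
      (fun _ ↦ toReal_nonneg) (hbdd f) (hbdd g) ?_
    · simp only [ENNReal.ofReal_toReal (hfin _ _)] at this
      exact this.trans (by gcongr; exact min_le_left _ _)
    · intro x y
      rw [← ENNReal.toReal_mul, ← ENNReal.toReal_pow]
      refine ENNReal.toReal_mono (ENNReal.pow_ne_top (hfin _ _)) ?_
      rcases le_total (h ((2 : ℝ)⁻¹ * (x + y))) N with hN | hN
      · rw [min_eq_left hN]
        exact (mul_le_mul' (min_le_left _ _) (min_le_left _ _)).trans (H x y)
      · rw [min_eq_right hN, sq]
        exact mul_le_mul' (min_le_right _ _) (min_le_right _ _)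
  have hsup : ∀ u : ℝ → ℝ≥0∞, Measurable u →
      ∫⁻ x, u x = ⨆ N : ℕ, ∫⁻ x, min (u x) N := by
    intro u hu
    rw [← lintegral_iSup (fun N ↦ by fun_prop) fun M N hMN x ↦ by
      dsimp only; gcongr]
    congr 1 with x
    rw [← inf_iSup_eq, ENNReal.iSup_natCast, inf_top_eq]
  have hmono : ∀ u : ℝ → ℝ≥0∞, Monotone fun N : ℕ ↦ ∫⁻ x, min (u x) N :=
    fun u M N hMN ↦ lintegral_mono fun x ↦ by dsimp only; gcongr
  rw [hsup f hf, hsup g hg, ENNReal.iSup_mul]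
  refine iSup_le fun M ↦ ?_
  rw [ENNReal.mul_iSup]
  refine iSup_le fun N ↦ le_trans ?_ (trunc (max M N))
  exact mul_le_mul' (hmono f (le_max_left M N)) (hmono g (le_max_right M N))

theorem PrekopaLeindler.prod {E F : Type*} [AddCommGroup E] [Module ℝ E] [MeasurableSpace E]
    [AddCommGroup F] [Module ℝ F] [MeasurableSpace F] {μ : Measure E} {ν : Measure F} [SFinite ν]
    (hμ : PrekopaLeindler μ) (hν : PrekopaLeindler ν) : PrekopaLeindler (μ.prod ν) := by
  intro f g h hf hg hh H
  rw [lintegral_prod _ hf.aemeasurable, lintegral_prod _ hg.aemeasurable,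
    lintegral_prod _ hh.aemeasurable]
  refine hμ _ _ _ hf.lintegral_prod_right' hg.lintegral_prod_right' hh.lintegral_prod_right' ?_
  intro x y
  exact hν _ _ _ (by fun_prop) (by fun_prop) (by fun_prop) fun x' y' ↦ H (x, x') (y, y')

theorem PrekopaLeindler.of_measurePreserving {E F : Type*} [AddCommGroup E] [Module ℝ E]
    [MeasurableSpace E] [AddCommGroup F] [Module ℝ F] [MeasurableSpace F] {μ : Measure E}
    {ν : Measure F} (hμ : PrekopaLeindler μ) (L : E →ₗ[ℝ] F) (hL : MeasurePreserving L μ ν) :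
    PrekopaLeindler ν := by
  intro f g h hf hg hh H
  rw [← hL.lintegral_comp hf, ← hL.lintegral_comp hg, ← hL.lintegral_comp hh]
  refine hμ _ _ _ (hf.comp hL.measurable) (hg.comp hL.measurable) (hh.comp hL.measurable) ?_
  intro x y
  simpa using H (L x) (L y)

theorem prekopaLeindler_pi (n : ℕ) : PrekopaLeindler (volume : Measure (Fin n → ℝ)) := by
  induction n with
  | zero =>
    intro f g h _ _ _ H
    rw [Measure.volume_pi_eq_dirac (0 : Fin 0 → ℝ)]
    simpa using H 0 0
  | succ n ih =>
    refine (prekopaLeindler_real.prod ih).of_measurePreserving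
      (Fin.consLinearEquiv ℝ (fun _ : Fin (n + 1) ↦ ℝ)).toLinearMap ?_
    have h := (volume_preserving_piFinSuccAbove (fun _ : Fin (n + 1) ↦ ℝ) 0).symm
    have e : ⇑(Fin.consLinearEquiv ℝ (fun _ : Fin (n + 1) ↦ ℝ)).toLinearMap =
        ⇑(MeasurableEquiv.piFinSuccAbove (fun _ : Fin (n + 1) ↦ ℝ) 0).symm := by
      funext x
      exact (Fin.insertNth_zero' x.1 x.2).symm
    rw [e]
    exact h

theorem prekopaLeindler_euclideanSpace (n : ℕ) :
    PrekopaLeindler (volume : Measure (EuclideanSpace ℝ (Fin n))) :=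
  (prekopaLeindler_pi n).of_measurePreserving (WithLp.linearEquiv 2 ℝ (Fin n → ℝ)).symm.toLinearMap
    (PiLp.volume_preserving_toLp (Fin n))

/-- The multiplicative Brunn–Minkowski inequality for midpoints. -/
theorem PrekopaLeindler.measure_mul_measure_le {E : Type*} [AddCommGroup E] [Module ℝ E]
    [MeasurableSpace E] {μ : Measure E} (hμ : PrekopaLeindler μ) {A B C : Set E}
    (hA : MeasurableSet A) (hB : MeasurableSet B) (hC : MeasurableSet C)
    (H : ∀ x ∈ A, ∀ y ∈ B, (2 : ℝ)⁻¹ • (x + y) ∈ C) : μ A * μ B ≤ μ C ^ 2 := by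
  have := hμ (A.indicator 1) (B.indicator 1) (C.indicator 1) (measurable_one.indicator hA)
    (measurable_one.indicator hB) (measurable_one.indicator hC) ?_
  · simpa [lintegral_indicator_one, hA, hB, hC] using this
  · intro x y
    by_cases hx : x ∈ A
    · by_cases hy : y ∈ B
      · rw [indicator_of_mem hx, indicator_of_mem hy, indicator_of_mem (H x hx y hy)]
        simp
      · simp [hy]
    · simp [hx]

section Body

variable {E : Type*} [NormedAddCommGroup E] [NormedSpace ℝ E] {K : Set E}

theorem IsSymmConvexBody.neg_mem (hK : IsSymmConvexBody K) {x : E} (hx : x ∈ K) : -x ∈ K := by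
  rw [hK.2.2.2] at hx
  exact hx

theorem IsSymmConvexBody.mem_nhds_zero (hK : IsSymmConvexBody K) : K ∈ nhds (0 : E) := by
  obtain ⟨-, hconv, ⟨x, hx⟩, hsymm⟩ := id hK
  rw [mem_interior_iff_mem_nhds] at hx
  have hx' : -x ∈ closure K := subset_closure (hK.neg_mem (mem_of_mem_nhds hx))
  have := hconv.combo_interior_closure_mem_interior (mem_interior_iff_mem_nhds.2 hx) hx'
    (by norm_num : (0 : ℝ) < 2⁻¹) (by norm_num : (0 : ℝ) ≤ 2⁻¹) (by norm_num)
  rw [mem_interior_iff_mem_nhds] at this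
  simpa using this

theorem IsSymmConvexBody.norm_le (hK : IsSymmConvexBody K) {x : E} (hx : x ∈ K) :
    ‖x‖ ≤ Metric.diam K / 2 := by
  have := Metric.dist_le_diam_of_mem hK.1.isBounded hx (hK.neg_mem hx)
  rw [dist_eq_norm, sub_neg_eq_add, ← two_smul ℝ x, norm_smul, Real.norm_two] at this
  linarith

theorem IsSymmConvexBody.mem_smul_of_gauge_le (hK : IsSymmConvexBody K) {r : ℝ} (hr : 0 < r)
    {x : E} (hx : gauge K x ≤ r) : x ∈ r • K := by
  rw [mem_smul_set_iff_inv_smul_mem₀ hr.ne', ← hK.1.isClosed.closure_eq,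
    ← gauge_le_one_iff_mem_closure hK.2.1 hK.mem_nhds_zero,
    gauge_smul_of_nonneg (inv_nonneg.2 hr.le), smul_eq_mul, inv_mul_le_iff₀ hr, mul_one]
  exact hx

theorem IsSymmConvexBody.modulusOfConvexity_le (hK : IsSymmConvexBody K) {x y : E} (hx : x ∈ K)
    (hy : y ∈ K) {ε : ℝ} (hε : ε ≤ gauge K (x - y)) :
    modulusOfConvexity K ε ≤ 1 - gauge K ((2 : ℝ)⁻¹ • (x + y)) := by
  refine csInf_le ⟨0, ?_⟩ ⟨x, y, gauge_le_one_of_mem hx, gauge_le_one_of_mem hy, hε, rfl⟩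
  rintro _ ⟨x, y, hx, hy, -, rfl⟩
  have := gauge_add_le hK.2.1 (absorbent_nhds_zero hK.mem_nhds_zero) x y
  rw [gauge_smul_of_nonneg (by norm_num), smul_eq_mul]
  linarith

theorem IsPConvex.midpoint_mem_smul {p α : ℝ} (hK : IsSymmConvexBody K)
    (hpc : IsPConvex K p α) (hd : 0 < Metric.diam K) {s : ℝ} (hs : 0 < s) {x y : E} (hx : x ∈ K)
    (hy : y ∈ K) (hxy : s ≤ dist x y) :
    (2 : ℝ)⁻¹ • (x + y) ∈ Real.exp (-(α * (2 * s / Metric.diam K) ^ p)) • K := by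
  have hsd : s ≤ Metric.diam K := hxy.trans (Metric.dist_le_diam_of_mem hK.1.isBounded hx hy)
  have hε : 2 * s / Metric.diam K ≤ gauge K (x - y) := by
    refine le_trans ?_ (le_gauge_of_subset_closedBall (absorbent_nhds_zero hK.mem_nhds_zero)
      (by positivity : 0 ≤ Metric.diam K / 2) fun z hz ↦ by simpa using hK.norm_le hz)
    rw [← dist_eq_norm, div_div_eq_mul_div, mul_comm]
    gcongr
  have h1 := hpc (2 * s / Metric.diam K) (by positivity) (by rw [div_le_iff₀ hd]; linarith)
  have h2 := hK.modulusOfConvexity_le hx hy hε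
  have h3 := Real.one_sub_le_exp_neg (α * (2 * s / Metric.diam K) ^ p)
  exact hK.mem_smul_of_gauge_le (Real.exp_pos _) (by linarith)

end Body

variable {n : ℕ} {K : Set (EuclideanSpace ℝ (Fin n))} {p α : ℝ}

/-- Subsets of a `p`-convex body of volume one at distance at least `s` from each other cannot both
have large measure. -/
theorem IsPConvex.measureReal_mul_measureReal_le (hK : IsSymmConvexBody K) (hvol : volume K = 1)
    (hpc : IsPConvex K p α) (hd : 0 < Metric.diam K) {s : ℝ} (hs : 0 < s)
    {A B : Set (EuclideanSpace ℝ (Fin n))} (hA : MeasurableSet A) (hB : MeasurableSet B)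
    (hAK : A ⊆ K) (hBK : B ⊆ K) (hAB : ∀ x ∈ A, ∀ y ∈ B, s ≤ dist x y) :
    volume.real A * volume.real B ≤
      Real.exp (-2 * α * n * (2 * s / Metric.diam K) ^ p) := by
  set r := Real.exp (-(α * (2 * s / Metric.diam K) ^ p)) with hr
  have hr0 : 0 < r := Real.exp_pos _
  have h := (prekopaLeindler_euclideanSpace n).measure_mul_measure_le hA hB
    (hK.1.smul r).measurableSet fun x hx y hy ↦
      hpc.midpoint_mem_smul hK hd hs (hAK hx) (hBK hy) (hAB x hx y hy)
  rw [Measure.addHaar_smul, hvol, mul_one, finrank_euclideanSpace_fin] at h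
  have h' := ENNReal.toReal_mono (by finiteness) h
  rw [ENNReal.toReal_mul, ENNReal.toReal_pow, ENNReal.toReal_ofReal (abs_nonneg _),
    abs_of_nonneg (by positivity)] at h'
  refine h'.trans_eq ?_
  rw [hr, ← Real.exp_nat_mul, ← Real.exp_nat_mul]
  congr 1
  push_cast
  ring

theorem MeasureTheory.integral_le_of_measureReal_le_exp {Ω : Type*} [MeasurableSpace Ω]
    {μ : Measure Ω} [IsFiniteMeasure μ] {g : Ω → ℝ} (hg : Integrable g μ) {C b : ℝ} (hb : 0 < b)
    (h : ∀ s > 0, μ.real {x | s ≤ g x} ≤ C * Real.exp (-b * s)) :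
    ∫ x, g x ∂μ ≤ C / b := by
  have hpos : Integrable (fun x ↦ max (g x) 0) μ := hg.pos_part
  have hexp : IntegrableOn (fun s ↦ C * Real.exp (-b * s)) (Ioi 0) :=
    (integrableOn_exp_mul_Ioi (neg_lt_zero.2 hb) 0).const_mul C
  calc ∫ x, g x ∂μ ≤ ∫ x, max (g x) 0 ∂μ := integral_mono hg hpos fun x ↦ le_max_left _ _
    _ = ∫ s in Ioi 0, μ.real {x | s ≤ max (g x) 0} :=
      hpos.integral_eq_integral_meas_le (Filter.Eventually.of_forall fun x ↦ le_max_right _ _)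
    _ ≤ ∫ s in Ioi 0, C * Real.exp (-b * s) := by
      refine integral_mono_of_nonneg (Filter.Eventually.of_forall fun s ↦ measureReal_nonneg) hexp ?_
      filter_upwards [ae_restrict_mem measurableSet_Ioi] with s hs
      refine le_trans (measureReal_mono fun x hx ↦ ?_) (h s hs)
      exact (le_max_iff.1 hx).resolve_right (not_le.2 (mem_Ioi.1 hs))
    _ = C / b := by
      rw [integral_const_mul, integral_exp_mul_Ioi (neg_lt_zero.2 hb)]
      simp [div_eq_mul_inv]

theorem Real.exp_neg_rpow_le_of_one_lt (hp : 1 ≤ p) (hd : 0 < Metric.diam K)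
    {t : ℝ} (ht : 0 < t) (hlarge : 1 < 2 * (1 / 4) ^ p * α * n * (t / Metric.diam K) ^ p)
    {s : ℝ} (hs : t / 8 ≤ s) :
    Real.exp (-2 * α * n * (2 * s / Metric.diam K) ^ p) ≤ Real.exp (-(8 / t) * s) := by
  rw [Real.exp_le_exp]
  have hs0 : 0 < s := by linarith
  have hu : 1 ≤ 8 / t * s := by
    rw [div_mul_eq_mul_div, le_div_iff₀ ht]
    linarith
  have h1 : (2 * s / Metric.diam K) ^ p =
      (1 / 4) ^ p * (t / Metric.diam K) ^ p * (8 / t * s) ^ p := by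
    rw [← Real.mul_rpow (by positivity) (by positivity),
      ← Real.mul_rpow (by positivity) (by positivity)]
    congr 1
    field_simp
    norm_num
  have h2 : 8 / t * s ≤ (8 / t * s) ^ p := Real.self_le_rpow_of_one_le hu hp
  rw [h1]
  nlinarith [mul_le_mul hlarge.le h2 (by linarith) (by linarith)]

/-- The upper-tail estimate, in the range where the exponent is large. -/
theorem IsPConvex.measureReal_upper_tail_le (hp : 1 ≤ p) (hK : IsSymmConvexBody K)
    (hvol : volume K = 1) (hα : 0 < α) (hpc : IsPConvex K p α) (hd : 0 < Metric.diam K)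
    {f : EuclideanSpace ℝ (Fin n) → ℝ} (hf : LipschitzWith 1 f) {t : ℝ} (ht : 0 < t)
    (hlarge : 1 < 2 * (1 / 4) ^ p * α * n * (t / Metric.diam K) ^ p) :
    volume.real {x | x ∈ K ∧ (∫ y in K, f y) + t ≤ f x} ≤
      2 * Real.exp (-2 * (1 / 4) ^ p * α * n * (t / Metric.diam K) ^ p) := by
  set a := ∫ y in K, f y with ha
  have hfc : Continuous f := hf.continuous
  have hKm : MeasurableSet K := hK.1.measurableSet
  have hlow : ∀ u, MeasurableSet {x | x ∈ K ∧ f x ≤ u} := fun u ↦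
    hKm.inter (measurableSet_le hfc.measurable measurable_const)
  have hupp : ∀ u, MeasurableSet {x | x ∈ K ∧ u ≤ f x} := fun u ↦
    hKm.inter (measurableSet_le measurable_const hfc.measurable)
  have hreal : volume.real K = 1 := by simp [Measure.real, hvol]
  have hKtop : volume K ≠ ⊤ := by simp [hvol]
  have : IsFiniteMeasure (volume.restrict K) := ⟨by simp [hvol]⟩
  have hsep : ∀ u s, 0 < s → volume.real {x | x ∈ K ∧ f x ≤ u - s} *
      volume.real {x | x ∈ K ∧ u ≤ f x} ≤
      Real.exp (-2 * α * n * (2 * s / Metric.diam K) ^ p) := by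
    intro u s hs
    refine hpc.measureReal_mul_measureReal_le hK hvol hd hs (hlow _) (hupp _)
      (fun x hx ↦ hx.1) (fun x hx ↦ hx.1) ?_
    rintro x ⟨-, hx⟩ y ⟨-, hy⟩
    have := hf.dist_le_mul x y
    rw [Real.dist_eq, NNReal.coe_one, one_mul] at this
    linarith [neg_abs_le (f x - f y)]
  have hhalf : 1 / 2 ≤ volume.real {x | x ∈ K ∧ f x ≤ a + t / 2} := by
    by_contra! hlt
    have hU : 1 / 2 < volume.real {x | x ∈ K ∧ a + t / 2 ≤ f x} := by
      have hcover : K ⊆ {x | x ∈ K ∧ f x ≤ a + t / 2} ∪ {x | x ∈ K ∧ a + t / 2 ≤ f x} :=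
        fun x hx ↦ (le_total (f x) (a + t / 2)).imp (⟨hx, ·⟩) (⟨hx, ·⟩)
      have h1 := (measureReal_mono hcover (measure_ne_top_of_subset
        (union_subset (fun x hx ↦ hx.1) fun x hx ↦ hx.1) hKtop)).trans (measureReal_union_le _ _)
      linarith
    have htail : ∀ s > 0, (volume.restrict K).real {x | s ≤ a + t / 2 - f x} ≤
        3 * Real.exp (-(8 / t) * s) := by
      intro s hs
      rw [measureReal_restrict_apply (measurableSet_le measurable_const (by fun_prop)),
        show {x | s ≤ a + t / 2 - f x} ∩ K = {x | x ∈ K ∧ f x ≤ a + t / 2 - s} by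
          ext x
          exact ⟨fun h ↦ ⟨h.2, le_sub_comm.1 h.1⟩, fun h ↦ ⟨le_sub_comm.1 h.2, h.1⟩⟩]
      rcases lt_or_ge s (t / 8) with hst | hst
      · have h1 : volume.real {x | x ∈ K ∧ f x ≤ a + t / 2 - s} ≤ 1 :=
          hreal ▸ measureReal_mono (fun x hx ↦ hx.1) hKtop
        have h2 : 8 / t * s ≤ 1 := by
          rw [div_mul_eq_mul_div, div_le_iff₀ ht]
          linarith
        have h3 : Real.exp (-1) ≤ Real.exp (-(8 / t) * s) := Real.exp_le_exp.2 (by linarith)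
        have h4 := Real.exp_neg_one_gt_d9
        linarith
      · have h1 := (hsep (a + t / 2) s hs).trans (Real.exp_neg_rpow_le_of_one_lt hp hd ht hlarge hst)
        have h2 : 0 ≤ volume.real {x | x ∈ K ∧ f x ≤ a + t / 2 - s} := measureReal_nonneg
        nlinarith [Real.exp_pos (-(8 / t) * s)]
    have hfi : Integrable f (volume.restrict K) := hfc.continuousOn.integrableOn_compact hK.1
    have h_int := integral_le_of_measureReal_le_exp
      ((integrable_const (a + t / 2)).sub hfi) (by positivity : 0 < 8 / t) htail
    rw [integral_sub' (integrable_const _) hfi, ← ha] at h_int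
    simp [hreal] at h_int
    field_simp at h_int
    linarith
  have h1 := hsep (a + t) (t / 2) (by positivity)
  rw [show a + t - t / 2 = a + t / 2 by ring, mul_div_cancel₀ _ (two_ne_zero' ℝ)] at h1
  have h2 : Real.exp (-2 * α * n * (t / Metric.diam K) ^ p) ≤
      Real.exp (-2 * (1 / 4) ^ p * α * n * (t / Metric.diam K) ^ p) := by
    have hq : (1 / 4 : ℝ) ^ p ≤ 1 := Real.rpow_le_one (by norm_num) (by norm_num) (by linarith)
    have : 0 ≤ α * n * (t / Metric.diam K) ^ p := by positivity
    rw [Real.exp_le_exp]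
    nlinarith
  have h3 : 0 ≤ volume.real {x | x ∈ K ∧ a + t ≤ f x} := measureReal_nonneg
  nlinarith

end PrekopaLeindler

theorem pConvex_concentration_mean :
    ∃ c : ℝ, 0 < c ∧
      ∀ (n : ℕ) (K : Set (EuclideanSpace ℝ (Fin n))) (p α : ℝ),
        1 ≤ p → IsSymmConvexBody K → volume K = 1 → 0 < α → IsPConvex K p α →
        ∀ (f : EuclideanSpace ℝ (Fin n) → ℝ), LipschitzWith 1 f →
        ∀ t : ℝ, 0 < t →
          volume {x | x ∈ K ∧ t ≤ |f x - ∫ y in K, f y|} ≤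
            ENNReal.ofReal
              (4 * Real.exp (-2 * c ^ p * α * n * (t / Metric.diam K) ^ p)) := by
  refine ⟨1 / 4, by norm_num, ?_⟩
  intro n K p α hp hK hvol hα hpc f hf t ht
  have hKtop : volume K ≠ ⊤ := by simp [hvol]
  have hfin : volume {x | x ∈ K ∧ t ≤ |f x - ∫ y in K, f y|} ≠ ⊤ :=
    measure_ne_top_of_subset (fun x hx ↦ hx.1) hKtop
  rw [← ENNReal.ofReal_toReal hfin]
  refine ENNReal.ofReal_le_ofReal ?_
  change volume.real _ ≤ _
  rcases le_or_gt (2 * (1 / 4) ^ p * α * n * (t / Metric.diam K) ^ p) 1 with hsmall | hlarge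
  · have h1 : volume.real {x | x ∈ K ∧ t ≤ |f x - ∫ y in K, f y|} ≤ volume.real K :=
      measureReal_mono (fun x hx ↦ hx.1) hKtop
    have h2 : volume.real K = 1 := by simp [Measure.real, hvol]
    have h3 : Real.exp (-1) ≤ Real.exp (-2 * (1 / 4) ^ p * α * n * (t / Metric.diam K) ^ p) :=
      Real.exp_le_exp.2 (by linarith)
    have h4 := Real.exp_neg_one_gt_d9
    linarith
  · have hd : 0 < Metric.diam K := by
      refine Metric.diam_nonneg.lt_of_ne fun h ↦ ?_
      rw [← h, div_zero, Real.zero_rpow (by linarith), mul_zero] at hlarge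
      linarith
    have h1 := hpc.measureReal_upper_tail_le hp hK hvol hα hd hf ht hlarge
    have h2 := hpc.measureReal_upper_tail_le hp hK hvol hα hd hf.neg ht hlarge
    have hsub : {x | x ∈ K ∧ t ≤ |f x - ∫ y in K, f y|} ⊆
        {x | x ∈ K ∧ (∫ y in K, f y) + t ≤ f x} ∪
          {x | x ∈ K ∧ (∫ y in K, (-f) y) + t ≤ (-f) x} := by
      rintro x ⟨hx, hxt⟩
      simp only [Pi.neg_apply, integral_neg]
      rcases le_abs.1 hxt with h | h
      · exact Or.inl ⟨hx, by linarith⟩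
      · exact Or.inr ⟨hx, by linarith⟩
    have h3 := (measureReal_mono hsub (measure_ne_top_of_subset
      (Set.union_subset (fun x hx ↦ hx.1) fun x hx ↦ hx.1) hKtop)).trans (measureReal_union_le _ _)
    linarith
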